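/- arXiv:2205.15728 — 8 statements merged into one kernel-verified Lean document; each statement's English description precedes it below -/
import Mathlib

section
/- Let R be an associative ring (not necessarily unital) satisfying the faithfulness conditions, let n ≥ 2, and let G = M_n(R). For indices p, q ∈ {1,…,n}, let G_pq denote the additive subgroup of G consisting of matrices all of whose entries outside position (p,q) vanish; 'n' denotes the last index. Let B : G × G → G be additive in each variable and satisfy: (i) for all p, q and all r ≠ s: B maps G_pp × G_qq into G_pp ∩ G_qq, maps G_pp × G_rs into G_rs, maps G_rs × G_pp into G_rs, and B(x, y) = 0 whenever x ∈ G_pq with p ≠ q and y ∈ G_rs with r ≠ s; (ii) if c ∈ G has all diagonal entries zero and B(c, a) = 0 for every a ∈ G_nn, then c = 0, and if c ∈ G has all diagonal entries zero and B(b, c) = 0 for every diagonal matrix b ∈ G whose (n,n)-entry is zero, then c = 0; (iii) if a ∈ G_nn and B(b, a) = 0 for every b ∈ G_nn, then a = 0; (iv) if c ∈ G is a diagonal matrix such that B(c, x) = 0 and B(x, c) = 0 for every x ∈ G_rs and every pair r ≠ s, then the diagonal matrix obtained from c by negating its (n,n)-entry lies in the center of G; (v) for every c in the center of G, writing c_pp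 ∈ G_pp for the matrix whose (p,p)-entry equals the (p,p)-entry of c and whose other entries are zero, one has B(c_pp, d_pp) = B(d_pp, c_pp) for all p and all d_pp ∈ G_pp, and B(c_pp, d_pp)·d_pn·d_nn = d_pp·d_pn·B(c_nn, d_nn) for all p and all d_pp ∈ G_pp, d_pn ∈ G_pn, d_nn ∈ G_nn; (vi) B(c_rr, B(c_kl, c_nn)) = B(B(c_rr, c_kl), c_nn) for all indices r, k, l and all c_rr ∈ G_rr, c_kl ∈ G_kl, c_nn ∈ G_nn. Suppose f : G × G → G satisfies f(x, 0) = f(0, x) = 0, B(f(x, y), z) = f(B(x, z), B(y, z)), and B(z, f(x, y)) = f(B(z, x), B(z, y)) for all x, y, z ∈ G. Then f(x, y) = 0 for all x, y ∈ G. -/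
/-- `SuppAt p q u` means the matrix `u` has all entries outside position `(p, q)` equal to
zero, i.e. `u` belongs to the summand `G_pq` of the generalized `n`-matrix ring. -/
def Matrix.SuppAt {R : Type*} [Zero R] {n : ℕ} (p q : Fin n)
    (u : Matrix (Fin n) (Fin n) R) : Prop :=
  ∀ i j, ¬(i = p ∧ j = q) → u i j = 0

/-- `Matrix.onlyAt p q c` is the matrix that keeps only the `(p, q)` entry of `c` and has
zeros elsewhere. -/
def Matrix.onlyAt {R : Type*} [Zero R] {n : ℕ} (p q : Fin n)
    (c : Matrix (Fin n) (Fin n) R) : Matrix (Fin n) (Fin n) R :=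
  Matrix.of fun i j => if i = p ∧ j = q then c i j else 0

namespace Matrix

section Supp

variable {R : Type*} {n : ℕ}

theorem suppAt_onlyAt [Zero R] (p q : Fin n) (c : Matrix (Fin n) (Fin n) R) :
    SuppAt p q (onlyAt p q c) := by
  intro i j hij
  simp [onlyAt, hij]

theorem onlyAt_eq_zero [Zero R] {p q : Fin n} {c : Matrix (Fin n) (Fin n) R}
    (hc : c p q = 0) : onlyAt p q c = 0 := by
  ext i j
  by_cases h : i = p ∧ j = q
  · simp [onlyAt, h, hc]
  · simp [onlyAt, h]

theorem sum_onlyAt [AddCommMonoid R] (c : Matrix (Fin n) (Fin n) R) :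
    ∑ i, ∑ j, onlyAt i j c = c := by
  ext a b
  simp [Matrix.sum_apply, onlyAt, ite_and]

/-- An additive predicate holds for `c` as soon as it holds for all entries of `c`, each viewed
as a matrix with a single nonzero entry. -/
theorem onlyAt_induction [AddCommMonoid R] {P : Matrix (Fin n) (Fin n) R → Prop}
    (h0 : P 0) (hadd : ∀ x y, P x → P y → P (x + y)) (c : Matrix (Fin n) (Fin n) R)
    (h : ∀ i j, c i j ≠ 0 → P (onlyAt i j c)) : P c := by
  have hP : ∀ i j, P (onlyAt i j c) := fun i j => by
    by_cases hc : c i j = 0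
    · rw [onlyAt_eq_zero hc]
      exact h0
    · exact h i j hc
  rw [← sum_onlyAt c]
  exact Finset.sum_induction _ P hadd h0 fun i _ =>
    Finset.sum_induction _ P hadd h0 fun j _ => hP i j

/-- `u` vanishes outside the diagonal. -/
def OnDiag [Zero R] (u : Matrix (Fin n) (Fin n) R) : Prop := ∀ i j, i ≠ j → u i j = 0

/-- `u` vanishes on the diagonal. -/
def OffDiag [Zero R] (u : Matrix (Fin n) (Fin n) R) : Prop := ∀ i, u i i = 0

theorem OnDiag.add [AddZeroClass R] {u v : Matrix (Fin n) (Fin n) R}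
    (hu : OnDiag u) (hv : OnDiag v) : OnDiag (u + v) :=
  fun i j h => by simp [hu i j h, hv i j h]

theorem OffDiag.add [AddZeroClass R] {u v : Matrix (Fin n) (Fin n) R}
    (hu : OffDiag u) (hv : OffDiag v) : OffDiag (u + v) := fun i => by simp [hu i, hv i]

theorem SuppAt.add [AddZeroClass R] {p q : Fin n} {u v : Matrix (Fin n) (Fin n) R}
    (hu : SuppAt p q u) (hv : SuppAt p q v) : SuppAt p q (u + v) :=
  fun i j h => by simp [hu i j h, hv i j h]

theorem SuppAt.onDiag [Zero R] {p : Fin n} {u : Matrix (Fin n) (Fin n) R}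
    (hu : SuppAt p p u) : OnDiag u := fun i j hij => hu i j fun h => hij (h.1.trans h.2.symm)

theorem SuppAt.offDiag [Zero R] {p q : Fin n} (hpq : p ≠ q) {u : Matrix (Fin n) (Fin n) R}
    (hu : SuppAt p q u) : OffDiag u := fun i => hu i i fun h => hpq (h.1.symm.trans h.2)

theorem exists_onDiag_add_offDiag [AddZeroClass R] (c : Matrix (Fin n) (Fin n) R) :
    ∃ d m, OnDiag d ∧ OffDiag m ∧ c = d + m := by
  refine ⟨Matrix.of fun i j => if i = j then c i j else 0,
    Matrix.of fun i j => if i = j then 0 else c i j, fun i j h => ?_, fun i => ?_, ?_⟩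
  · simp [h]
  · simp
  · ext i j
    by_cases h : i = j <;> simp [h]

theorem eq_zero_of_onDiag_add_offDiag [AddZeroClass R] {d m : Matrix (Fin n) (Fin n) R}
    (hd : OnDiag d) (hm : OffDiag m) (h : d + m = 0) : d = 0 ∧ m = 0 := by
  have hij : ∀ i j, d i j + m i j = 0 := fun i j => by rw [← add_apply, h, zero_apply]
  refine ⟨?_, ?_⟩ <;> ext i j <;> rcases eq_or_ne i j with rfl | hne
  · simpa [hm i] using hij i i
  · exact hd i j hne
  · exact hm i
  · simpa [hd i j hne] using hij i j

theorem suppAt_single [Zero R] (p q : Fin n) (a : R) : SuppAt p q (single p q a) :=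
  fun _ _ h => single_apply_of_ne _ _ _ _ _ fun h' => h ⟨h'.1.symm, h'.2.symm⟩

end Supp

/-- A biadditive map on `n × n` matrices which respects the decomposition into the entries. -/
structure PeirceBiadditive {R : Type*} [NonUnitalRing R] {n : ℕ}
    (B : Matrix (Fin n) (Fin n) R → Matrix (Fin n) (Fin n) R → Matrix (Fin n) (Fin n) R) :
    Prop where
  add_left : ∀ x y z, B (x + y) z = B x z + B y z
  add_right : ∀ x y z, B x (y + z) = B x y + B x z
  diag_diag : ∀ (p q : Fin n) (x y : Matrix (Fin n) (Fin n) R),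
    SuppAt p p x → SuppAt q q y → SuppAt p p (B x y) ∧ SuppAt q q (B x y)
  diag_off : ∀ (p r s : Fin n), r ≠ s → ∀ (x y : Matrix (Fin n) (Fin n) R),
    SuppAt p p x → SuppAt r s y → SuppAt r s (B x y)
  off_diag : ∀ (p r s : Fin n), r ≠ s → ∀ (x y : Matrix (Fin n) (Fin n) R),
    SuppAt r s x → SuppAt p p y → SuppAt r s (B x y)
  off_off : ∀ (p q r s : Fin n), p ≠ q → r ≠ s → ∀ (x y : Matrix (Fin n) (Fin n) R),
    SuppAt p q x → SuppAt r s y → B x y = 0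

namespace PeirceBiadditive

variable {R : Type*} [NonUnitalRing R] {n : ℕ}
  {B : Matrix (Fin n) (Fin n) R → Matrix (Fin n) (Fin n) R → Matrix (Fin n) (Fin n) R}
  {x y z c d m : Matrix (Fin n) (Fin n) R} {p : Fin n}

theorem zero_left (hB : PeirceBiadditive B) (x : Matrix (Fin n) (Fin n) R) : B 0 x = 0 := by
  simpa using hB.add_left 0 0 x

theorem zero_right (hB : PeirceBiadditive B) (x : Matrix (Fin n) (Fin n) R) : B x 0 = 0 := by
  simpa using hB.add_right x 0 0

theorem neg_left (hB : PeirceBiadditive B) (x y : Matrix (Fin n) (Fin n) R) :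
    B (-x) y = -B x y := by
  rw [eq_neg_iff_add_eq_zero, ← hB.add_left, neg_add_cancel, hB.zero_left]

theorem neg_right (hB : PeirceBiadditive B) (x y : Matrix (Fin n) (Fin n) R) :
    B x (-y) = -B x y := by
  rw [eq_neg_iff_add_eq_zero, ← hB.add_right, neg_add_cancel, hB.zero_right]

/-- The opposite of an entrywise compatible biadditive map is again such a map. -/
theorem flip (hB : PeirceBiadditive B) : PeirceBiadditive fun x y => B y x where
  add_left x y z := hB.add_right z x y
  add_right x y z := hB.add_left y z x
  diag_diag p q x y hx hy := (hB.diag_diag q p y x hy hx).symm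
  diag_off p r s h x y hx hy := hB.off_diag p r s h y x hy hx
  off_diag p r s h x y hx hy := hB.diag_off p r s h y x hy hx
  off_off p q r s h h' x y hx hy := hB.off_off r s p q h' h y x hy hx

theorem induction₂ (hB : PeirceBiadditive B) {P : Matrix (Fin n) (Fin n) R → Prop} (h0 : P 0)
    (hadd : ∀ u v, P u → P v → P (u + v)) (x y : Matrix (Fin n) (Fin n) R)
    (h : ∀ i j k l, x i j ≠ 0 → y k l ≠ 0 → P (B (onlyAt i j x) (onlyAt k l y))) :
    P (B x y) := by
  refine onlyAt_induction (P := fun x => P (B x y)) (by rwa [hB.zero_left])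
    (fun u v hu hv => by rw [hB.add_left]; exact hadd _ _ hu hv) x fun i j hx => ?_
  refine onlyAt_induction (P := fun y => P (B _ y)) (by rwa [hB.zero_right])
    (fun u v hu hv => by rw [hB.add_right]; exact hadd _ _ hu hv) y fun k l hy => ?_
  exact h i j k l hx hy

theorem offDiag_of_onDiag_left (hB : PeirceBiadditive B) (hd : OnDiag d) (hm : OffDiag m) :
    OffDiag (B d m) := by
  refine hB.induction₂ (fun _ => rfl) (fun _ _ => OffDiag.add) d m fun i j k l hi hk => ?_
  obtain rfl : i = j := not_not.1 fun h => hi (hd i j h)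
  have hkl : k ≠ l := by
    rintro rfl
    exact hk (hm k)
  exact (hB.diag_off i k l hkl _ _ (suppAt_onlyAt _ _ _) (suppAt_onlyAt _ _ _)).offDiag hkl

theorem offDiag_of_onDiag_right (hB : PeirceBiadditive B) (hm : OffDiag m) (hd : OnDiag d) :
    OffDiag (B m d) :=
  hB.flip.offDiag_of_onDiag_left hd hm

theorem eq_zero_of_offDiag (hB : PeirceBiadditive B) (hx : OffDiag x) (hy : OffDiag y) :
    B x y = 0 := by
  refine hB.induction₂ (P := fun u => u = 0) rfl (fun u v hu hv => by simp [hu, hv]) x y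
    fun i j k l hi hk => ?_
  have hij : i ≠ j := by
    rintro rfl
    exact hi (hx i)
  have hkl : k ≠ l := by
    rintro rfl
    exact hk (hy k)
  exact hB.off_off i j k l hij hkl _ _ (suppAt_onlyAt _ _ _) (suppAt_onlyAt _ _ _)

theorem suppAt_of_onDiag_left (hB : PeirceBiadditive B) (hd : OnDiag d) (hz : SuppAt p p z) :
    SuppAt p p (B d z) := by
  refine onlyAt_induction (P := fun d => SuppAt p p (B d z)) (by simp [hB.zero_left, SuppAt])
    (fun u v hu hv => by rw [hB.add_left]; exact hu.add hv) d fun i j hi => ?_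
  obtain rfl : i = j := not_not.1 fun h => hi (hd i j h)
  exact (hB.diag_diag i p _ _ (suppAt_onlyAt _ _ _) hz).2

theorem onDiag (hB : PeirceBiadditive B) (hx : OnDiag x) (hy : OnDiag y) : OnDiag (B x y) := by
  refine onlyAt_induction (P := fun y => OnDiag (B x y)) (by simp [hB.zero_right, OnDiag])
    (fun u v hu hv => by rw [hB.add_right]; exact hu.add hv) y fun i j hi => ?_
  obtain rfl : i = j := not_not.1 fun h => hi (hy i j h)
  exact (hB.suppAt_of_onDiag_left hx (suppAt_onlyAt _ _ _)).onDiag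

theorem offDiag_right (hB : PeirceBiadditive B) (x : Matrix (Fin n) (Fin n) R)
    (hm : OffDiag m) : OffDiag (B x m) := by
  obtain ⟨d, u, hd, hu, rfl⟩ := exists_onDiag_add_offDiag x
  rw [hB.add_left, hB.eq_zero_of_offDiag hu hm, add_zero]
  exact hB.offDiag_of_onDiag_left hd hm

theorem eq_onlyAt_left (hB : PeirceBiadditive B) (hd : OnDiag d) (hz : SuppAt p p z) :
    B d z = B (onlyAt p p d) z := by
  have hsub : B (d - onlyAt p p d) z = 0 := by
    refine onlyAt_induction (P := fun d => B d z = 0) (hB.zero_left z)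
      (fun u v hu hv => by rw [hB.add_left, hu, hv, add_zero]) _ fun i j hi => ?_
    obtain rfl : i = j := not_not.1 fun h => hi <| by
      simp [hd i j h, (suppAt_onlyAt p p d).onDiag i j h]
    have hip : i ≠ p := by
      rintro rfl
      simp [onlyAt] at hi
    have hs := hB.diag_diag i p _ _ (suppAt_onlyAt i i (d - onlyAt p p d)) hz
    ext a b
    by_cases h : a = i ∧ b = i
    · exact hs.2 a b fun h' => hip (h.1.symm.trans h'.1)
    · exact hs.1 a b h
  rw [← add_zero (B (onlyAt p p d) z), ← hsub, ← hB.add_left, add_sub_cancel]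

theorem eq_zero_of_apply_eq_zero (hB : PeirceBiadditive B) (hd : OnDiag d) (hp : d p p = 0)
    (hz : SuppAt p p z) : B d z = 0 := by
  rw [hB.eq_onlyAt_left hd hz, onlyAt_eq_zero hp, hB.zero_left]

end PeirceBiadditive

theorem onlyAt_twist {R : Type*} [NonUnitalRing R] {n : ℕ} (e : Fin n)
    (d : Matrix (Fin n) (Fin n) R) :
    onlyAt e e (Matrix.of fun i j => if i = e ∧ j = e then -(d i j) else d i j) =
      -onlyAt e e d := by
  ext i j
  by_cases h : i = e ∧ j = e <;> simp [onlyAt, h]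

theorem onlyAt_twist_of_ne {R : Type*} [NonUnitalRing R] {n : ℕ} {e p : Fin n} (hp : p ≠ e)
    (d : Matrix (Fin n) (Fin n) R) :
    onlyAt p p (Matrix.of fun i j => if i = e ∧ j = e then -(d i j) else d i j) =
      onlyAt p p d := by
  ext i j
  by_cases h : i = p ∧ j = p <;> simp [onlyAt, h, hp]

/-- If the `(e, e)` entry of a diagonal matrix commuting, up to a sign in that entry, with all
matrices is zero, then so is the matrix. -/
theorem eq_zero_of_twist_mem_center {R : Type*} [NonUnitalRing R] {n : ℕ} {e : Fin n}
    (hl : ∀ a : R, (∀ b : R, a * b = 0) → a = 0) {d : Matrix (Fin n) (Fin n) R}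
    (hd : OnDiag d) (he : d e e = 0)
    (hc : (Matrix.of fun i j => if i = e ∧ j = e then -(d i j) else d i j) ∈
      Set.center (Matrix (Fin n) (Fin n) R)) : d = 0 := by
  have htwist : (Matrix.of fun i j => if i = e ∧ j = e then -(d i j) else d i j) = d := by
    ext i j
    by_cases h : i = e ∧ j = e
    · simp [h, he]
    · simp [h]
  rw [htwist] at hc
  ext i j
  rcases eq_or_ne i j with rfl | hij
  · refine hl _ fun b => ?_
    have h := congrFun (congrFun (hc.comm (single i e b)) i) e
    rw [mul_single_apply_same, single_mul_apply_same, he, mul_zero] at h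
    exact h
  · exact hd i j hij

end Matrix

open Matrix

/-- The Main Theorem (Theorem 2.1 of Ferreira–Jabeen) specialized to the generalized
`n`-matrix ring `G = M_n(R)`, where `R` is a (not necessarily unital) ring satisfying
the faithfulness conditions and `en` is the last index. -/
theorem main_theorem_biadditive_map_matrix
    {R : Type*} [NonUnitalRing R]
    (hl : ∀ a : R, (∀ b : R, a * b = 0) → a = 0)
    (hr : ∀ a : R, (∀ b : R, b * a = 0) → a = 0)
    (n : ℕ) (hn : 2 ≤ n) (en : Fin n) (hen : (en : ℕ) = n - 1)
    (B : Matrix (Fin n) (Fin n) R → Matrix (Fin n) (Fin n) R → Matrix (Fin n) (Fin n) R)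
    -- B is biadditive
    (haddl : ∀ x y z, B (x + y) z = B x z + B y z)
    (haddr : ∀ x y z, B x (y + z) = B x y + B x z)
    -- condition (i)
    (hi1 : ∀ (p q : Fin n) (x y : Matrix (Fin n) (Fin n) R),
      Matrix.SuppAt p p x → Matrix.SuppAt q q y →
      Matrix.SuppAt p p (B x y) ∧ Matrix.SuppAt q q (B x y))
    (hi2 : ∀ (p r s : Fin n), r ≠ s → ∀ (x y : Matrix (Fin n) (Fin n) R),
      Matrix.SuppAt p p x → Matrix.SuppAt r s y → Matrix.SuppAt r s (B x y))
    (hi3 : ∀ (p r s : Fin n), r ≠ s → ∀ (x y : Matrix (Fin n) (Fin n) R),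
      Matrix.SuppAt r s x → Matrix.SuppAt p p y → Matrix.SuppAt r s (B x y))
    (hi4 : ∀ (p q r s : Fin n), p ≠ q → r ≠ s → ∀ (x y : Matrix (Fin n) (Fin n) R),
      Matrix.SuppAt p q x → Matrix.SuppAt r s y → B x y = 0)
    -- condition (ii)
    (hii1 : ∀ c : Matrix (Fin n) (Fin n) R, (∀ i, c i i = 0) →
      (∀ a, Matrix.SuppAt en en a → B c a = 0) → c = 0)
    (hii2 : ∀ c : Matrix (Fin n) (Fin n) R, (∀ i, c i i = 0) →
      (∀ b : Matrix (Fin n) (Fin n) R,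
        (∀ i j, i ≠ j → b i j = 0) → b en en = 0 → B b c = 0) → c = 0)
    -- condition (iii)
    (hiii : ∀ a : Matrix (Fin n) (Fin n) R, Matrix.SuppAt en en a →
      (∀ b, Matrix.SuppAt en en b → B b a = 0) → a = 0)
    -- condition (iv)
    (hiv : ∀ c : Matrix (Fin n) (Fin n) R, (∀ i j, i ≠ j → c i j = 0) →
      (∀ (r s : Fin n), r ≠ s → ∀ x, Matrix.SuppAt r s x → B c x = 0 ∧ B x c = 0) →
      (Matrix.of fun i j => if i = en ∧ j = en then -(c i j) else c i j) ∈
        Set.center (Matrix (Fin n) (Fin n) R))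
    -- condition (v)
    (hv1 : ∀ c ∈ Set.center (Matrix (Fin n) (Fin n) R), ∀ (p : Fin n) dpp,
      Matrix.SuppAt p p dpp →
      B (Matrix.onlyAt p p c) dpp = B dpp (Matrix.onlyAt p p c))
    (hv2 : ∀ c ∈ Set.center (Matrix (Fin n) (Fin n) R), ∀ (p : Fin n) dpp dpn dnn,
      Matrix.SuppAt p p dpp → Matrix.SuppAt p en dpn → Matrix.SuppAt en en dnn →
      B (Matrix.onlyAt p p c) dpp * dpn * dnn = dpp * dpn * B (Matrix.onlyAt en en c) dnn)
    -- condition (vi)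
    (hvi : ∀ (r k l : Fin n) (crr ckl cnn : Matrix (Fin n) (Fin n) R),
      Matrix.SuppAt r r crr → Matrix.SuppAt k l ckl → Matrix.SuppAt en en cnn →
      B crr (B ckl cnn) = B (B crr ckl) cnn)
    (f : Matrix (Fin n) (Fin n) R → Matrix (Fin n) (Fin n) R → Matrix (Fin n) (Fin n) R)
    -- conditions (vii), (viii), (ix)
    (hf0 : ∀ x, f x 0 = 0 ∧ f 0 x = 0)
    (hf1 : ∀ x y z, B (f x y) z = f (B x z) (B y z))
    (hf2 : ∀ x y z, B z (f x y) = f (B z x) (B z y)) :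
    ∀ x y, f x y = 0 := by
  have hB : PeirceBiadditive B := ⟨haddl, haddr, hi1, hi2, hi3, hi4⟩
  have hpe : ∃ p : Fin n, p ≠ en := by
    refine ⟨⟨0, by omega⟩, fun h => ?_⟩
    have h' := congrArg Fin.val h
    simp only at h'
    omega
  obtain ⟨p, hp⟩ := hpe
  have eq_zero_of_nn : ∀ c, (∀ x, OffDiag x → B c x = 0 ∧ B x c = 0) →
      (∀ z, SuppAt en en z → B c z = 0) → c = 0 := by
    intro c hoff hnn
    obtain ⟨d, m, hd, hm, rfl⟩ := exists_onDiag_add_offDiag c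
    have hz : ∀ z, SuppAt en en z → B d z = 0 ∧ B m z = 0 := fun z hz =>
      eq_zero_of_onDiag_add_offDiag (hB.suppAt_of_onDiag_left hd hz).onDiag
        (hB.offDiag_of_onDiag_right hm hz.onDiag) (by rw [← hB.add_left, hnn z hz])
    obtain rfl : m = 0 := hii1 m hm fun z h => (hz z h).2
    rw [add_zero] at hoff ⊢
    have hcen := hiv d hd fun r s hrs x hx => hoff x (hx.offDiag hrs)
    refine eq_zero_of_twist_mem_center hl hd ?_ hcen
    have hzero : onlyAt en en d = 0 := by
      refine hiii _ (suppAt_onlyAt _ _ _) fun b hb => ?_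
      have h := hv1 _ hcen en b hb
      rw [onlyAt_twist, hB.neg_left, hB.neg_right, neg_inj, ← hB.eq_onlyAt_left hd hb,
        (hz b hb).1] at h
      exact h.symm
    simpa [onlyAt] using congrFun (congrFun hzero en) en
  have eq_zero_of_corner : ∀ c, (∀ x, OffDiag x → B c x = 0 ∧ B x c = 0) →
      (∀ z, OnDiag z → z en en = 0 → B z c = 0) → c = 0 := by
    intro c hoff hcorner
    obtain ⟨d, m, hd, hm, rfl⟩ := exists_onDiag_add_offDiag c
    have hz : ∀ z, OnDiag z → z en en = 0 → B z d = 0 ∧ B z m = 0 := fun z hz hze =>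
      eq_zero_of_onDiag_add_offDiag (hB.onDiag hz hd)
        (hB.offDiag_of_onDiag_left hz hm) (by rw [← hB.add_right, hcorner z hz hze])
    obtain rfl : m = 0 := hii2 m hm fun z h h' => (hz z h h').2
    rw [add_zero] at hoff ⊢
    have hcen := hiv d hd fun r s hrs x hx => hoff x (hx.offDiag hrs)
    refine eq_zero_of_nn d hoff fun z hze => ?_
    have hpp : ∀ w, SuppAt p p w → B (onlyAt p p d) w = 0 := fun w hw => by
      have h := hv1 _ hcen p w hw
      rw [onlyAt_twist_of_ne hp] at h
      rw [h, ← hB.flip.eq_onlyAt_left hd hw]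
      exact (hz w hw.onDiag (hw en en fun h => hp h.1.symm)).1
    have hsupp := hB.suppAt_of_onDiag_left hd hze
    have hentry : B d z en en = 0 := by
      refine hr _ fun b => hr _ fun a => ?_
      have h := hv2 _ hcen p (single p p a) (single p en b) z (suppAt_single _ _ _)
        (suppAt_single _ _ _) hze
      rw [onlyAt_twist_of_ne hp, hpp _ (suppAt_single _ _ _), onlyAt_twist, hB.neg_left,
        ← hB.eq_onlyAt_left hd hze, zero_mul, zero_mul, mul_neg, zero_eq_neg, mul_assoc] at h
      simpa using congrFun (congrFun h p) en
    ext i j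
    by_cases h : i = en ∧ j = en
    · rw [h.1, h.2, hentry, Matrix.zero_apply]
    · exact hsupp i j h
  have corner_off : ∀ r v, OnDiag r → r en en = 0 → OffDiag v → f r v = 0 := by
    intro r v hr' hre hv
    refine eq_zero_of_nn _ (fun x hx => ⟨?_, ?_⟩) fun z hz => ?_
    · rw [hf1, hB.eq_zero_of_offDiag hv hx, (hf0 _).1]
    · rw [hf2, hB.eq_zero_of_offDiag hx hv, (hf0 _).1]
    · rw [hf1, hB.eq_zero_of_apply_eq_zero hr' hre hz, (hf0 _).2]
  have assoc : ∀ r u z, OnDiag r → SuppAt en en z → B r (B u z) = B (B r u) z := by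
    intro r u z hr' hz
    refine onlyAt_induction (P := fun u => B r (B u z) = B (B r u) z) ?_ ?_ u fun k l _ => ?_
    · simp only [hB.zero_left, hB.zero_right]
    · intro u v hu hv
      simp only [hB.add_left, hB.add_right, hu, hv]
    refine onlyAt_induction (P := fun r => B r (B _ z) = B (B r _) z) ?_ ?_ r fun i j hi => ?_
    · simp only [hB.zero_left]
    · intro u v hu hv
      simp only [hB.add_left, hu, hv]
    obtain rfl : i = j := not_not.1 fun h => hi (hr' i j h)
    exact hvi i k l _ _ _ (suppAt_onlyAt _ _ _) (suppAt_onlyAt _ _ _) hz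
  have off_off_annihilates : ∀ u v, OffDiag u → OffDiag v →
      ∀ x, OffDiag x → B (f u v) x = 0 ∧ B x (f u v) = 0 := fun u v hu hv x hx => by
    rw [hf1, hf2, hB.eq_zero_of_offDiag hu hx, hB.eq_zero_of_offDiag hx hu]
    exact ⟨(hf0 _).2, (hf0 _).2⟩
  have off_off : ∀ u v, OffDiag u → OffDiag v → f u v = 0 := by
    have hmul : ∀ r u v, OnDiag r → r en en = 0 → OffDiag u → OffDiag v →
        f (B r u) v = 0 := by
      intro r u v hr' hre hu hv
      refine eq_zero_of_nn _
        (off_off_annihilates _ _ (hB.offDiag_of_onDiag_left hr' hu) hv) fun z hz => ?_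
      have h := hf1 r v (z + B u z)
      rw [corner_off r v hr' hre hv, hB.zero_left, hB.add_right, hB.add_right,
        hB.eq_zero_of_apply_eq_zero hr' hre hz, zero_add,
        hB.eq_zero_of_offDiag hv (hB.offDiag_of_onDiag_right hu hz.onDiag), add_zero,
        assoc r u z hr' hz] at h
      rw [hf1, ← h]
    intro u v hu hv
    refine eq_zero_of_corner _ (off_off_annihilates u v hu hv) fun z hz hze => ?_
    rw [hf2]
    exact hmul z u _ hz hze hu (hB.offDiag_of_onDiag_left hz hv)
  have annihilates : ∀ x y w, OffDiag w → B (f x y) w = 0 ∧ B w (f x y) = 0 := by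
    intro x y w hw
    rw [hf1, hf2]
    exact ⟨off_off _ _ (hB.offDiag_right x hw) (hB.offDiag_right y hw),
      off_off _ _ (hB.flip.offDiag_right x hw) (hB.flip.offDiag_right y hw)⟩
  have offDiag_corner : ∀ z' x z, OnDiag z' → z' en en = 0 → SuppAt en en z →
      OffDiag (B z' (B x z)) := by
    intro z' x z hz' hze hz
    obtain ⟨d, m, hd, hm, rfl⟩ := exists_onDiag_add_offDiag x
    rw [hB.add_left, hB.add_right,
      hB.eq_zero_of_apply_eq_zero hz' hze (hB.suppAt_of_onDiag_left hd hz), zero_add]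
    exact hB.offDiag_of_onDiag_left hz' (hB.offDiag_of_onDiag_right hm hz.onDiag)
  intro x y
  refine eq_zero_of_nn _ (annihilates x y) fun z hz => ?_
  rw [hf1]
  refine eq_zero_of_corner _ (annihilates _ _) fun z' hz' hze => ?_
  rw [hf2]
  exact off_off _ _ (offDiag_corner z' x z hz' hze hz) (offDiag_corner z' y z hz' hze hz)
end

section
/- Let R be an associative ring (not necessarily unital) satisfying the faithfulness conditions, let n ≥ 2 and let k ≥ 1. Suppose a map f : M_n(R) × M_n(R) → M_n(R) satisfies: f(x, 0) = f(0, x) = 0 for all x; f(x, y)·z₁·z₂⋯z_k = f(x·z₁·z₂⋯z_k, y·z₁·z₂⋯z_k) for all x, y, z₁, …, z_k ∈ M_n(R); and z₁·z₂⋯z_k·f(x, y) = f(z₁·z₂⋯z_k·x, z₁·z₂⋯z_k·y) for all x, y, z₁, …, z_k ∈ M_n(R). Then f(x, y) = 0 for all x, y ∈ M_n(R). -/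
theorem foldl_mul_add {A : Type*} [NonUnitalRing A] (l : List A) (a b : A) :
    l.foldl (· * ·) (a + b) = l.foldl (· * ·) a + l.foldl (· * ·) b := by
  induction l generalizing a b with
  | nil => rfl
  | cons c l ih => simp only [List.foldl_cons, add_mul, ih]

theorem foldl_mul_mul {A : Type*} [NonUnitalRing A] (l : List A) (a b : A) :
    l.foldl (· * ·) (a * b) = a * l.foldl (· * ·) b := by
  induction l generalizing b with
  | nil => rfl
  | cons c l ih => simp only [List.foldl_cons, mul_assoc, ih]

theorem foldl_mul_single {ι R : Type*} [Fintype ι] [DecidableEq ι] [NonUnitalRing R]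
    (l : List R) (b : R) (i j : ι) :
    (l.map (Matrix.single j j)).foldl (· * ·) (Matrix.single i j b) =
      Matrix.single i j (l.foldl (· * ·) b) := by
  induction l generalizing b with
  | nil => rfl
  | cons c l ih => simp only [List.map_cons, List.foldl_cons, Matrix.single_mul_single_same, ih]

theorem eq_zero_of_foldl_mul_eq_zero {R : Type*} [NonUnitalRing R]
    (hl : ∀ a : R, (∀ b : R, a * b = 0) → a = 0) (m : ℕ) (a : R)
    (h : ∀ l : List R, l.length = m → l.foldl (· * ·) a = 0) : a = 0 := by
  induction m generalizing a with
  | zero => exact h [] rfl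
  | succ m ih =>
    exact hl a fun b => ih (a * b) fun l hlen => h (b :: l) (by simp [hlen])

/-- In a ring without left annihilators, products of `m + 1` factors also have none. -/
theorem eq_zero_of_mul_foldl_mul_eq_zero {R : Type*} [NonUnitalRing R]
    (hl : ∀ a : R, (∀ b : R, a * b = 0) → a = 0) (m : ℕ) (a : R)
    (h : ∀ (b : R) (l : List R), l.length = m → a * l.foldl (· * ·) b = 0) : a = 0 :=
  hl a fun b => eq_zero_of_foldl_mul_eq_zero hl m _ fun l hlen => by
    rw [foldl_mul_mul, h b l hlen]

/-- A matrix over such a ring vanishes if it is annihilated on the right by all single-entry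
matrices in column `q` whose entry is a product of `m + 1` factors. -/
theorem matrix_eq_zero_of_mul_single_eq_zero {ι R : Type*} [Fintype ι] [DecidableEq ι]
    [NonUnitalRing R] (hl : ∀ a : R, (∀ b : R, a * b = 0) → a = 0) (m : ℕ) (q : ι)
    (M : Matrix ι ι R)
    (h : ∀ (j : ι) (b : R) (l : List R), l.length = m →
      M * Matrix.single j q (l.foldl (· * ·) b) = 0) : M = 0 := by
  ext i j
  refine eq_zero_of_mul_foldl_mul_eq_zero hl m _ fun b l hlen => ?_
  simpa using congrFun (congrFun (h j b l hlen) i) q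


/-- Corollary 2.2 of Ferreira–Jabeen specialized to `M_n(R)`: if
`f (x, y) z₁ ⋯ z_k = f (x z₁ ⋯ z_k, y z₁ ⋯ z_k)` and
`z₁ ⋯ z_k f (x, y) = f (z₁ ⋯ z_k x, z₁ ⋯ z_k y)` plus `f (x, 0) = f (0, x) = 0`,
then `f = 0`.  Right multiplication by `z₁ ⋯ z_k` is expressed via `List.foldl` and left
multiplication by `z₁ ⋯ z_k` via `List.foldr`. -/
theorem corollary_f_eq_zero_matrix
    {R : Type*} [NonUnitalRing R]
    (hl : ∀ a : R, (∀ b : R, a * b = 0) → a = 0)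
    (hr : ∀ a : R, (∀ b : R, b * a = 0) → a = 0)
    (n : ℕ) (hn : 2 ≤ n) (k : ℕ) (hk : 1 ≤ k)
    (f : Matrix (Fin n) (Fin n) R → Matrix (Fin n) (Fin n) R → Matrix (Fin n) (Fin n) R)
    (hf0 : ∀ x, f x 0 = 0 ∧ f 0 x = 0)
    (hfr : ∀ (x y : Matrix (Fin n) (Fin n) R) (z : Fin k → Matrix (Fin n) (Fin n) R),
      (List.ofFn z).foldl (· * ·) (f x y) =
        f ((List.ofFn z).foldl (· * ·) x) ((List.ofFn z).foldl (· * ·) y))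
    (hfl : ∀ (x y : Matrix (Fin n) (Fin n) R) (z : Fin k → Matrix (Fin n) (Fin n) R),
      (List.ofFn z).foldr (· * ·) (f x y) =
        f ((List.ofFn z).foldr (· * ·) x) ((List.ofFn z).foldr (· * ·) y)) :
    ∀ x y, f x y = 0 := by
  obtain ⟨m, rfl⟩ : ∃ m, k = m + 1 := ⟨k - 1, by omega⟩
  let p : Fin n := ⟨0, by omega⟩
  let r : Fin n := ⟨1, by omega⟩
  have hpr : p ≠ r := by simp [p, r]
  have hmul : ∀ (x y t : Matrix (Fin n) (Fin n) R) (l : List (Matrix (Fin n) (Fin n) R)),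
      l.length = m → f x y * l.foldl (· * ·) t =
        f (x * l.foldl (· * ·) t) (y * l.foldl (· * ·) t) := by
    rintro x y t l rfl
    simpa [List.ofFn_succ, foldl_mul_mul] using hfr x y (Fin.cons t l.get)
  have hsingle : ∀ (x y : Matrix (Fin n) (Fin n) R) (j : Fin n) (b : R) (l : List R),
      l.length = m → f x y * Matrix.single j p (l.foldl (· * ·) b) =
        f (x * Matrix.single j p (l.foldl (· * ·) b))
          (y * Matrix.single j p (l.foldl (· * ·) b)) := by
    intro x y j b l hlen
    simpa only [foldl_mul_single] using
      hmul x y (Matrix.single j p b) (l.map (Matrix.single p p)) (by simpa using hlen)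
  have hcols : ∀ (x y : Matrix (Fin n) (Fin n) R) (j : Fin n) (b : R),
      f (x * Matrix.single j p b) (y * Matrix.single j r b) = 0 := by
    intro x y j b
    refine matrix_eq_zero_of_mul_single_eq_zero hl m p _ fun i c l hlen => ?_
    rw [hsingle _ _ _ _ _ hlen, mul_assoc, mul_assoc]
    by_cases hi : p = i
    · rw [Matrix.single_mul_single_of_ne (h := fun h => hpr (hi.trans h.symm)), mul_zero]
      exact (hf0 _).1
    · rw [Matrix.single_mul_single_of_ne (h := hi), mul_zero]
      exact (hf0 _).2
  intro x y
  refine matrix_eq_zero_of_mul_single_eq_zero hl m p _ fun j b l hlen => ?_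
  refine matrix_eq_zero_of_mul_single_eq_zero hl m p _ fun i c l' hlen' => ?_
  by_cases hi : p = i
  · subst hi
    rw [hsingle _ _ _ _ _ hlen, hsingle _ _ _ _ _ hlen']
    have h := hmul (x * Matrix.single j p (l.foldl (· * ·) b))
      (y * Matrix.single j r (l.foldl (· * ·) b)) (Matrix.single p p c + Matrix.single r p c)
      (l'.map (Matrix.single p p)) (by simpa using hlen')
    rw [hcols, zero_mul, foldl_mul_add, foldl_mul_single, foldl_mul_single] at h
    simpa [mul_assoc, mul_add, Matrix.single_mul_single_of_ne, hpr, hpr.symm] using h.symm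
  · rw [mul_assoc, Matrix.single_mul_single_of_ne (h := hi), mul_zero]
end

section
/- Let R be an associative ring (not necessarily unital) satisfying the faithfulness conditions, let n ≥ 2 and let k ≥ 1. Suppose a map f : M_n(R) × M_n(R) → M_n(R) satisfies f(x, y)·z₁·z₂⋯z_k = f(x·z₁·z₂⋯z_k, y·z₁·z₂⋯z_k) and z₁·z₂⋯z_k·f(x, y) = f(z₁·z₂⋯z_k·x, z₁·z₂⋯z_k·y) for all x, y, z₁, …, z_k ∈ M_n(R). Then in fact f(x, y)·z = f(x·z, y·z) and z·f(x, y) = f(z·x, z·y) for all x, y, z ∈ M_n(R). -/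
/-- If right multiplications separate points, so do right multiplications by products of `k`
elements. -/
theorem List.eq_of_forall_foldl_mul_eq {S : Type*} [Mul S]
    (h : ∀ a b : S, (∀ c, a * c = b * c) → a = b) (k : ℕ) {a b : S}
    (hab : ∀ l : List S, l.length = k → l.foldl (· * ·) a = l.foldl (· * ·) b) : a = b := by
  induction k generalizing a b with
  | zero => simpa using hab [] rfl
  | succ k ih =>
    exact h a b fun c => ih fun l hl => by simpa using hab (c :: l) (by simp [hl])

/-- If left multiplications separate points, so do left multiplications by products of `k`
elements. -/
theorem List.eq_of_forall_foldr_mul_eq {S : Type*} [Mul S]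
    (h : ∀ a b : S, (∀ c, c * a = c * b) → a = b) (k : ℕ) {a b : S}
    (hab : ∀ l : List S, l.length = k → l.foldr (· * ·) a = l.foldr (· * ·) b) : a = b := by
  induction k generalizing a b with
  | zero => simpa using hab [] rfl
  | succ k ih =>
    exact h a b fun c => ih fun l hl => by simpa using hab (l ++ [c]) (by simp [hl])

/-- Right multiplications separate points of a matrix ring if they do so in the base ring. -/
theorem Matrix.eq_of_forall_mul_right_eq {R m : Type*} [NonUnitalRing R] [Fintype m]
    (hR : ∀ a : R, (∀ b : R, a * b = 0) → a = 0)
    (A B : Matrix m m R) (h : ∀ C, A * C = B * C) : A = B := by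
  classical
  ext i j
  refine sub_eq_zero.mp (hR _ fun b => ?_)
  have hij := congrFun (congrFun (h (Matrix.single j j b)) i) j
  simpa [sub_mul, sub_eq_zero] using hij

/-- Left multiplications separate points of a matrix ring if they do so in the base ring. -/
theorem Matrix.eq_of_forall_mul_left_eq {R m : Type*} [NonUnitalRing R] [Fintype m]
    (hR : ∀ a : R, (∀ b : R, b * a = 0) → a = 0)
    (A B : Matrix m m R) (h : ∀ C, C * A = C * B) : A = B := by
  classical
  ext i j
  refine sub_eq_zero.mp (hR _ fun b => ?_)
  have hij := congrFun (congrFun (h (Matrix.single i i b)) i) j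
  simpa [mul_sub, sub_eq_zero] using hij

/-- If right multiplications separate points, a binary map commuting with right multiplication by
products of `k + 1` elements commutes with right multiplication by single elements. -/
theorem map_mul_right_of_foldl {S : Type*} [Semigroup S]
    (h : ∀ a b : S, (∀ c, a * c = b * c) → a = b) (k : ℕ) (f : S → S → S)
    (hf : ∀ (x y : S) (l : List S), l.length = k + 1 →
      l.foldl (· * ·) (f x y) = f (l.foldl (· * ·) x) (l.foldl (· * ·) y)) (x y z : S) :
    f x y * z = f (x * z) (y * z) := by
  refine h _ _ fun c => List.eq_of_forall_foldl_mul_eq h k fun l hl => ?_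
  have h₁ := hf x y ((z * c) :: l) (by simp [hl])
  have h₂ := hf (x * z) (y * z) (c :: l) (by simp [hl])
  simp only [List.foldl_cons, ← mul_assoc] at h₁ h₂
  exact h₁.trans h₂.symm

/-- If left multiplications separate points, a binary map commuting with left multiplication by
products of `k + 1` elements commutes with left multiplication by single elements. -/
theorem map_mul_left_of_foldr {S : Type*} [Semigroup S]
    (h : ∀ a b : S, (∀ c, c * a = c * b) → a = b) (k : ℕ) (f : S → S → S)
    (hf : ∀ (x y : S) (l : List S), l.length = k + 1 →
      l.foldr (· * ·) (f x y) = f (l.foldr (· * ·) x) (l.foldr (· * ·) y)) (x y z : S) :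
    z * f x y = f (z * x) (z * y) := by
  refine h _ _ fun c => List.eq_of_forall_foldr_mul_eq h k fun l hl => ?_
  have h₁ := hf x y (l ++ [c * z]) (by simp [hl])
  have h₂ := hf (z * x) (z * y) (l ++ [c]) (by simp [hl])
  simp only [List.foldr_append, List.foldr_cons, List.foldr_nil, mul_assoc] at h₁ h₂
  exact h₁.trans h₂.symm

/-- The intermediate claim in the proof of Corollary 2.2 of Ferreira–Jabeen, specialized
to `M_n(R)`: from the `k`-fold conditions
`f (x, y) z₁ ⋯ z_k = f (x z₁ ⋯ z_k, y z₁ ⋯ z_k)` and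
`z₁ ⋯ z_k f (x, y) = f (z₁ ⋯ z_k x, z₁ ⋯ z_k y)` one deduces
`f (x, y) z = f (xz, yz)` and `z f (x, y) = f (zx, zy)` for all `x, y, z`.
Right multiplication by `z₁ ⋯ z_k` is expressed via `List.foldl` and left multiplication
via `List.foldr`. -/
theorem corollary_one_step_matrix
    {R : Type*} [NonUnitalRing R]
    (hl : ∀ a : R, (∀ b : R, a * b = 0) → a = 0)
    (hr : ∀ a : R, (∀ b : R, b * a = 0) → a = 0)
    (n : ℕ) (hn : 2 ≤ n) (k : ℕ) (hk : 1 ≤ k)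
    (f : Matrix (Fin n) (Fin n) R → Matrix (Fin n) (Fin n) R → Matrix (Fin n) (Fin n) R)
    (hfr : ∀ (x y : Matrix (Fin n) (Fin n) R) (z : Fin k → Matrix (Fin n) (Fin n) R),
      (List.ofFn z).foldl (· * ·) (f x y) =
        f ((List.ofFn z).foldl (· * ·) x) ((List.ofFn z).foldl (· * ·) y))
    (hfl : ∀ (x y : Matrix (Fin n) (Fin n) R) (z : Fin k → Matrix (Fin n) (Fin n) R),
      (List.ofFn z).foldr (· * ·) (f x y) =
        f ((List.ofFn z).foldr (· * ·) x) ((List.ofFn z).foldr (· * ·) y)) :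
    ∀ x y z : Matrix (Fin n) (Fin n) R,
      f x y * z = f (x * z) (y * z) ∧ z * f x y = f (z * x) (z * y) := by
  obtain ⟨k, rfl⟩ := Nat.exists_eq_add_of_le' hk
  intro x y z
  constructor
  · refine map_mul_right_of_foldl (Matrix.eq_of_forall_mul_right_eq hl) k f
      (fun x y l h => ?_) x y z
    obtain ⟨w, rfl⟩ : ∃ w : Fin (k + 1) → _, List.ofFn w = l := by
      rw [← h]
      exact ⟨l.get, List.ofFn_get l⟩
    exact hfr x y w
  · refine map_mul_left_of_foldr (Matrix.eq_of_forall_mul_left_eq hr) k f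
      (fun x y l h => ?_) x y z
    obtain ⟨w, rfl⟩ : ∃ w : Fin (k + 1) → _, List.ofFn w = l := by
      rw [← h]
      exact ⟨l.get, List.ofFn_get l⟩
    exact hfl x y w
end

section
/- Let R be an associative ring (not necessarily unital) satisfying the faithfulness conditions, let n ≥ 2 and m ≥ 2, and let d : M_n(R) → M_n(R) be a map such that d(x₁·x₂⋯x_m) = Σ_{i=1}^{m} x₁⋯x_{i-1}·d(x_i)·x_{i+1}⋯x_m for all x₁, …, x_m ∈ M_n(R). Then d is additive, i.e., d(x + y) = d(x) + d(y) for all x, y ∈ M_n(R). -/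
/-- The ordered product `x 0 * x 1 * ⋯ * x m` of a nonempty tuple of elements of a
magma (no unit required). -/
def prodNE {G : Type*} [Mul G] : ∀ {m : ℕ}, (Fin (m + 1) → G) → G
  | 0, x => x 0
  | m + 1, x => prodNE (fun i : Fin (m + 1) => x i.castSucc) * x (Fin.last (m + 1))

lemma cons_castSucc {A : Type*} {k : ℕ} (z : A) (w : Fin (k + 1) → A) :
    (fun i : Fin (k + 1) => (Fin.cons z w : Fin (k + 1 + 1) → A) i.castSucc) =
      Fin.cons z (fun i : Fin k => w i.castSucc) := by
  funext i
  refine Fin.cases rfl (fun j => ?_) i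
  rw [← Fin.succ_castSucc, Fin.cons_succ, Fin.cons_succ]

section TupleProducts

variable {A : Type*} [NonUnitalRing A]

lemma prodNE_cons_succ {k : ℕ} (z : A) (w : Fin (k + 1) → A) :
    prodNE (Fin.cons z w : Fin (k + 1 + 1) → A) =
      prodNE (Fin.cons z (fun i : Fin k => w i.castSucc) : Fin (k + 1) → A) * w (Fin.last k) := by
  rw [prodNE, cons_castSucc, ← Fin.succ_last, Fin.cons_succ]

lemma prodNE_cons_add : ∀ {k : ℕ} (w : Fin k → A) (y z : A),
    prodNE (Fin.cons (y + z) w : Fin (k + 1) → A) =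
      prodNE (Fin.cons y w : Fin (k + 1) → A) + prodNE (Fin.cons z w : Fin (k + 1) → A)
  | 0, _, _, _ => rfl
  | k + 1, w, y, z => by
    rw [prodNE_cons_succ, prodNE_cons_succ, prodNE_cons_succ, prodNE_cons_add, add_mul]

/-- Right multiplication by the entries of a tuple, `z ↦ z * w 0 * ⋯ * w (k - 1)`. -/
def tupleMulRight {k : ℕ} (w : Fin k → A) : A →+ A :=
  AddMonoidHom.mk' (fun z => prodNE (Fin.cons z w : Fin (k + 1) → A)) (prodNE_cons_add w)

lemma prodNE_cons_cons : ∀ {k : ℕ} (w : Fin k → A) (u v : A),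
    prodNE (Fin.cons u (Fin.cons v w : Fin (k + 1) → A) : Fin (k + 1 + 1) → A) =
      tupleMulRight w (u * v)
  | 0, _, _, _ => rfl
  | k + 1, w, u, v => by
    rw [prodNE_cons_succ, cons_castSucc, prodNE_cons_cons, ← Fin.succ_last, Fin.cons_succ]
    exact (prodNE_cons_succ (u * v) w).symm

lemma eq_zero_of_tupleMulRight (hA : ∀ a : A, (∀ b, a * b = 0) → a = 0) :
    ∀ {k : ℕ} (z : A), (∀ w : Fin k → A, tupleMulRight w z = 0) → z = 0
  | 0, _, h => h Fin.elim0
  | k + 1, z, h => by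
    refine eq_zero_of_tupleMulRight hA (k := k) z fun w => hA _ fun b => ?_
    have hb := h (Fin.snoc w b)
    change prodNE (Fin.cons z _ : Fin (k + 1 + 1) → A) = 0 at hb
    rw [prodNE_cons_succ] at hb
    simpa [tupleMulRight] using hb

lemma map_tupleMulRight_mul {k : ℕ} {d : A → A}
    (hder : ∀ x : Fin (k + 2) → A,
      d (prodNE x) = ∑ i : Fin (k + 2), prodNE (Function.update x i (d (x i))))
    (w : Fin k → A) (u v : A) :
    d (tupleMulRight w (u * v)) = tupleMulRight w (d u * v + u * d v) +
      (∑ i, tupleMulRight (Function.update w i (d (w i)))) (u * v) := by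
  have h := hder (Fin.cons u (Fin.cons v w : Fin (k + 1) → A))
  rw [prodNE_cons_cons, Fin.sum_univ_succ, Fin.sum_univ_succ] at h
  simp only [Fin.cons_zero, Fin.cons_succ, Fin.update_cons_zero, ← Fin.cons_update,
    prodNE_cons_cons] at h
  rw [h, map_add, AddMonoidHom.finsetSum_apply, add_assoc]

end TupleProducts

section Additivity

variable {A W : Type*} [NonUnitalRing A] {d : A → A} {T S : W → A →+ A}

lemma map_zero_of_twisted_leibniz [Nonempty W]
    (hd : ∀ w u v, d (T w (u * v)) = T w (d u * v + u * d v) + S w (u * v)) : d 0 = 0 := by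
  obtain ⟨w⟩ := ‹Nonempty W›
  simpa using hd w 0 0

variable (hd : ∀ w u v, d (T w (u * v)) = T w (d u * v + u * d v) + S w (u * v))
  (hT : ∀ z, (∀ w, T w z = 0) → z = 0)

include hd hT

lemma map_sum_of_mul_right {ι : Type*} (s : Finset ι) (x : ι → A) (C : Set A)
    (hC : ∀ a : A, (∀ c ∈ C, a * c = 0) → a = 0)
    (h : ∀ w, ∀ c ∈ C, d (T w ((∑ i ∈ s, x i) * c)) = ∑ i ∈ s, d (T w (x i * c))) :
    d (∑ i ∈ s, x i) = ∑ i ∈ s, d (x i) := by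
  refine sub_eq_zero.1 (hC _ fun c hc => hT _ fun w => ?_)
  have := h w c hc
  simp only [hd, map_add, Finset.sum_add_distrib, ← map_sum, ← Finset.sum_mul] at this
  rw [sub_mul, map_sub, sub_eq_zero]
  exact add_right_cancel (add_right_cancel this)

lemma map_sum_of_mul_left {ι : Type*} (s : Finset ι) (x : ι → A) (C : Set A)
    (hC : ∀ a : A, (∀ c ∈ C, c * a = 0) → a = 0)
    (h : ∀ w, ∀ c ∈ C, d (T w (c * ∑ i ∈ s, x i)) = ∑ i ∈ s, d (T w (c * x i))) :
    d (∑ i ∈ s, x i) = ∑ i ∈ s, d (x i) := by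
  refine sub_eq_zero.1 (hC _ fun c hc => hT _ fun w => ?_)
  have := h w c hc
  simp only [hd, map_add, Finset.sum_add_distrib, ← map_sum, ← Finset.mul_sum] at this
  rw [mul_sub, map_sub, sub_eq_zero]
  exact add_left_cancel (add_right_cancel this)

end Additivity

section Matrices

open Matrix

variable {ι R : Type*} [Fintype ι] [DecidableEq ι] [NonUnitalRing R]

/-- The matrices with at most one nonzero entry. -/
def singleEntryMatrices (ι R : Type*) [DecidableEq ι] [Zero R] : Set (Matrix ι ι R) :=
  {c | ∃ i j r, c = single i j r}

lemma eq_zero_of_mul_singleEntry (hl : ∀ a : R, (∀ b : R, a * b = 0) → a = 0)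
    (a : Matrix ι ι R) (h : ∀ c ∈ singleEntryMatrices ι R, a * c = 0) : a = 0 := by
  ext i j
  refine hl _ fun b => ?_
  simpa using congrFun (congrFun (h _ ⟨j, j, b, rfl⟩) i) j

lemma eq_zero_of_singleEntry_mul (hr : ∀ a : R, (∀ b : R, b * a = 0) → a = 0)
    (a : Matrix ι ι R) (h : ∀ c ∈ singleEntryMatrices ι R, c * a = 0) : a = 0 := by
  ext i j
  refine hr _ fun b => ?_
  simpa using congrFun (congrFun (h _ ⟨i, i, b, rfl⟩) i) j

variable (hl : ∀ a : R, (∀ b : R, a * b = 0) → a = 0)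
  (hr : ∀ a : R, (∀ b : R, b * a = 0) → a = 0)
  {W : Type*} [Nonempty W] {d : Matrix ι ι R → Matrix ι ι R}
  {T S : W → Matrix ι ι R →+ Matrix ι ι R}
  (hd : ∀ w u v, d (T w (u * v)) = T w (d u * v + u * d v) + S w (u * v))
  (hT : ∀ z, (∀ w, T w z = 0) → z = 0)

include hl hr hd hT

lemma map_eq_sum_single (x : Matrix ι ι R) : d x = ∑ i, ∑ j, d (single i j (x i j)) := by
  have hd0 : d 0 = 0 := map_zero_of_twisted_leibniz hd
  conv_lhs => rw [matrix_eq_sum_single x]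
  rw [map_sum_of_mul_left hd hT Finset.univ _ _ (eq_zero_of_singleEntry_mul hr)]
  · refine Finset.sum_congr rfl fun i _ => ?_
    rw [map_sum_of_mul_right hd hT Finset.univ _ _ (eq_zero_of_mul_singleEntry hl)]
    rintro w _ ⟨k, l, r, rfl⟩
    have h : ∀ j, j ≠ k → single i j (x i j) * single k l r = 0 := fun j hj =>
      single_mul_single_of_ne _ _ _ _ hj _
    rw [Finset.sum_mul, Finset.sum_eq_single k (fun j _ hj => h j hj) (by simp),
      Finset.sum_eq_single k (fun j _ hj => by rw [h j hj, map_zero, hd0]) (by simp)]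
  · rintro w _ ⟨k, l, r, rfl⟩
    have h : ∀ i, i ≠ l → single k l r * ∑ j, single i j (x i j) = 0 := fun i hi => by
      rw [Finset.mul_sum]
      exact Finset.sum_eq_zero fun j _ => single_mul_single_of_ne _ _ _ _ hi.symm _
    rw [Finset.mul_sum, Finset.sum_eq_single l (fun i _ hi => h i hi) (by simp)]
    symm
    refine Finset.sum_eq_single l (fun i _ hi => ?_) (by simp)
    rw [h i hi, map_zero, hd0]

lemma map_add_of_disjoint_entries (x y : Matrix ι ι R) (h : ∀ i j, x i j = 0 ∨ y i j = 0) :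
    d (x + y) = d x + d y := by
  have hd0 : d 0 = 0 := map_zero_of_twisted_leibniz hd
  rw [map_eq_sum_single hl hr hd hT (x + y), map_eq_sum_single hl hr hd hT x,
    map_eq_sum_single hl hr hd hT y]
  simp only [← Finset.sum_add_distrib]
  refine Finset.sum_congr rfl fun i _ => Finset.sum_congr rfl fun j _ => ?_
  rcases h i j with h | h <;> simp [h, hd0]

lemma map_single_mul_add [Nontrivial ι] (w : W) (i l : ι) (a b c : R) :
    d (T w (single i l (a * c + b * c))) =
      d (T w (single i l (a * c))) + d (T w (single i l (b * c))) := by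
  have hd0 : d 0 = 0 := map_zero_of_twisted_leibniz hd
  obtain ⟨p, q, hpq⟩ := exists_pair_ne ι
  have hU := map_add_of_disjoint_entries hl hr hd hT (single i p a) (single i q b)
    fun s t => by simp only [single_apply]; grind
  have hV := map_add_of_disjoint_entries hl hr hd hT (single p l c) (single q l c)
    fun s t => by simp only [single_apply]; grind
  have h₁ := hd w (single i p a) (single p l c)
  have h₂ := hd w (single i q b) (single q l c)
  have h₃ := hd w (single i p a) (single q l c)
  have h₄ := hd w (single i q b) (single p l c)
  have h := hd w (single i p a + single i q b) (single p l c + single q l c)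
  rw [hU, hV] at h
  simp only [add_mul, mul_add, single_mul_single_same, single_mul_single_of_ne _ _ _ _ hpq,
    single_mul_single_of_ne _ _ _ _ hpq.symm, map_add, map_zero, hd0, add_zero, zero_add]
    at h h₁ h₂ h₃ h₄
  rw [single_add, map_add, h, h₁, h₂]
  grind

lemma map_add_of_twisted_leibniz [Nontrivial ι] (x y : Matrix ι ι R) :
    d (x + y) = d x + d y := by
  have hd0 : d 0 = 0 := map_zero_of_twisted_leibniz hd
  rw [map_eq_sum_single hl hr hd hT (x + y), map_eq_sum_single hl hr hd hT x,
    map_eq_sum_single hl hr hd hT y]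
  simp only [← Finset.sum_add_distrib]
  refine Finset.sum_congr rfl fun i _ => Finset.sum_congr rfl fun j _ => ?_
  have h := map_sum_of_mul_right hd hT Finset.univ ![single i j (x i j), single i j (y i j)] _
    (eq_zero_of_mul_singleEntry hl) ?_
  · simpa [single_add] using h
  · rintro w _ ⟨k, l, c, rfl⟩
    simp only [Fin.sum_univ_two, cons_val_zero, cons_val_one]
    by_cases hjk : j = k
    · subst hjk
      rw [← single_add, single_mul_single_same, single_mul_single_same, single_mul_single_same,
        add_mul, map_single_mul_add hl hr hd hT]
    · simp [add_mul, single_mul_single_of_ne _ _ _ _ hjk, hd0]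

end Matrices

/-- Theorem 3.2 of Ferreira–Jabeen specialized to `M_n(R)`: for a (not necessarily unital)
ring `R` satisfying the faithfulness conditions, `n ≥ 2` and `m = m₀ + 2 ≥ 2`, every
`m`-multiplicative derivation `d` of `M_n(R)`, i.e. a map satisfying
`d (x₁ ⋯ x_m) = ∑ i, x₁ ⋯ d (x_i) ⋯ x_m`, is additive. -/
theorem m_multiplicative_derivation_additive
    {R : Type*} [NonUnitalRing R]
    (hl : ∀ a : R, (∀ b : R, a * b = 0) → a = 0)
    (hr : ∀ a : R, (∀ b : R, b * a = 0) → a = 0)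
    (n : ℕ) (hn : 2 ≤ n) (m₀ : ℕ)
    (d : Matrix (Fin n) (Fin n) R → Matrix (Fin n) (Fin n) R)
    (hder : ∀ x : Fin (m₀ + 2) → Matrix (Fin n) (Fin n) R,
      d (prodNE x) = ∑ i : Fin (m₀ + 2), prodNE (Function.update x i (d (x i)))) :
    ∀ x y : Matrix (Fin n) (Fin n) R, d (x + y) = d x + d y := by
  have : Nontrivial (Fin n) := Fin.nontrivial_iff_two_le.2 hn
  exact map_add_of_twisted_leibniz hl hr (map_tupleMulRight_mul hder)
    (eq_zero_of_tupleMulRight fun a h => eq_zero_of_mul_singleEntry hl a fun c _ => h c)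
end

section
/- Let R be a unital associative ring, let n ≥ 2 and m ≥ 2, let S be any associative ring, and let φ : M_n(R) → S be a bijection such that φ(x₁·x₂⋯x_m) = φ(x₁)·φ(x₂)⋯φ(x_m) for all x₁, …, x_m ∈ M_n(R). Then φ is additive, i.e., φ(x + y) = φ(x) + φ(y) for all x, y ∈ M_n(R). -/
theorem prodNE_eq_list_prod {M : Type*} [Monoid M] :
    ∀ {k : ℕ} (x : Fin (k + 1) → M), prodNE x = (List.ofFn x).prod
  | 0, x => by simp [prodNE]
  | k + 1, x => by
    rw [prodNE, prodNE_eq_list_prod, List.ofFn_succ' x]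
    simp [mul_assoc]

theorem prodNE_cons_cons_one {M : Type*} [Monoid M] {k : ℕ} (a b : M) :
    prodNE (Fin.cons a (Fin.cons b 1 : Fin (k + 1) → M) : Fin (k + 2) → M) = a * b := by
  simp [prodNE_eq_list_prod, List.ofFn_succ]

theorem prodNE_update_add {S : Type*} [NonUnitalRing S] :
    ∀ {k : ℕ} (w : Fin (k + 1) → S) (p : Fin (k + 1)) (s t : S),
      prodNE (Function.update w p (s + t)) =
        prodNE (Function.update w p s) + prodNE (Function.update w p t)
  | 0, w, p, s, t => by
    obtain rfl := Fin.fin_one_eq_zero p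
    simp [prodNE]
  | k + 1, w, p, s, t => by
    induction p using Fin.lastCases with
    | last =>
      have h (u : S) : (fun i : Fin (k + 1) =>
          Function.update w (Fin.last (k + 1)) u i.castSucc) = fun i => w i.castSucc := by
        funext i
        exact Function.update_of_ne (Fin.castSucc_lt_last i).ne _ _
      simp only [prodNE, h, Function.update_self, mul_add]
    | cast q =>
      have h (u : S) : (fun i : Fin (k + 1) => Function.update w q.castSucc u i.castSucc) =
          Function.update (fun i => w i.castSucc) q u := by
        funext i
        simp [Function.update_apply]
      have hlast (u : S) : Function.update w q.castSucc u (Fin.last (k + 1)) =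
          w (Fin.last (k + 1)) :=
        Function.update_of_ne (Fin.castSucc_lt_last q).ne' _ _
      simp only [prodNE, h, hlast, prodNE_update_add, add_mul]

/-- A second operation over which the multiplication of a ring distributes, with the same zero,
agrees with the addition on the off-diagonal Peirce component `e A (1 - e)`. -/
theorem op_eq_add_of_offDiagonal {A : Type*} [Ring A] (op : A → A → A)
    (zero_op : ∀ x, op 0 x = x) (op_zero : ∀ x, op x 0 = x)
    (mul_op : ∀ a x y, a * op x y = op (a * x) (a * y))
    (op_mul : ∀ x y a, op x y * a = op (x * a) (y * a))
    {e x y : A} (he : e * e = e) (hex : e * x = x)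
    (hye : y * e = 0) : op x y = x + y := by
  have hxy : y * x = 0 := by rw [← hex, ← mul_assoc, hye, zero_mul]
  have h₁ : op e y = e + y := by
    calc op e y = op e y * e + op e y * (1 - e) := by noncomm_ring
      _ = e + y := by simp [op_mul, mul_sub, he, hye, op_zero, zero_op]
  have h₂ : op x (1 - e) = x + (1 - e) := by
    calc op x (1 - e) = e * op x (1 - e) + (1 - e) * op x (1 - e) := by noncomm_ring
      _ = x + (1 - e) := by simp [mul_op, mul_sub, sub_mul, he, hex, op_zero, zero_op]
  calc op x y = op e y * op x (1 - e) := by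
        simp [op_mul, mul_op, mul_sub, he, hex, hye, hxy, op_zero, zero_op]
    _ = x + y := by
        rw [h₁, h₂]
        simp [add_mul, mul_add, mul_sub, he, hex, hye, hxy]

/-- The addition of a matrix ring of size at least two is determined by its multiplication. -/
theorem Matrix.op_eq_add {R ι : Type*} [Ring R] [Fintype ι] [DecidableEq ι] [Nontrivial ι]
    (op : Matrix ι ι R → Matrix ι ι R → Matrix ι ι R)
    (zero_op : ∀ x, op 0 x = x) (op_zero : ∀ x, op x 0 = x)
    (mul_op : ∀ a x y, a * op x y = op (a * x) (a * y))
    (op_mul : ∀ x y a, op x y * a = op (x * a) (y * a))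
    (x y : Matrix ι ι R) : op x y = x + y := by
  ext p q
  obtain ⟨r, hr⟩ := exists_ne p
  have hentry (z : Matrix ι ι R) :
      Matrix.single p p 1 * z * Matrix.single q r 1 = Matrix.single p r (z p q) := by
    simp
  have h : op (Matrix.single p r (x p q)) (Matrix.single p r (y p q)) =
      Matrix.single p r (x p q) + Matrix.single p r (y p q) := by
    apply op_eq_add_of_offDiagonal op zero_op op_zero mul_op op_mul
      (e := Matrix.single p p 1) <;> simp [hr]
  have hz := hentry (op x y)
  rw [mul_op, op_mul, hentry, hentry, h, ← Matrix.single_add] at hz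
  simpa using (congrFun (congrFun hz p) r).symm

/-- For a unital ring `R`, `n ≥ 2` and `m = m₀ + 2 ≥ 2`, every `m`-multiplicative
isomorphism `φ` from `M_n(R)` onto a ring `S` is additive (instance of Theorem 3.1 of
Ferreira–Jabeen). -/
theorem m_multiplicative_isomorphism_additive_of_unital
    {R S : Type*} [Ring R] [NonUnitalRing S]
    (n : ℕ) (hn : 2 ≤ n) (m₀ : ℕ)
    (φ : Matrix (Fin n) (Fin n) R → S)
    (hbij : Function.Bijective φ)
    (hmul : ∀ x : Fin (m₀ + 2) → Matrix (Fin n) (Fin n) R,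
      φ (prodNE x) = prodNE fun i => φ (x i)) :
    ∀ x y : Matrix (Fin n) (Fin n) R, φ (x + y) = φ x + φ y := by
  have : Nontrivial (Fin n) := Fin.nontrivial_iff_two_le.mpr hn
  have hex (x y : Matrix (Fin n) (Fin n) R) : ∃ z, φ z = φ x + φ y := hbij.2 _
  choose op hop using hex
  have hupdate (w : Fin (m₀ + 2) → Matrix (Fin n) (Fin n) R) (p : Fin (m₀ + 2))
      (x y : Matrix (Fin n) (Fin n) R) :
      prodNE (Function.update w p (op x y)) =
        op (prodNE (Function.update w p x)) (prodNE (Function.update w p y)) := by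
    apply hbij.1
    have h (z : Matrix (Fin n) (Fin n) R) :
        φ (prodNE (Function.update w p z)) = prodNE (Function.update (φ ∘ w) p (φ z)) := by
      rw [hmul, ← Function.comp_update]
      rfl
    rw [hop, h, h, h, hop, prodNE_update_add]
  have mul_op (a x y : Matrix (Fin n) (Fin n) R) : a * op x y = op (a * x) (a * y) := by
    have h (z : Matrix (Fin n) (Fin n) R) :
        prodNE (Function.update (Fin.cons a 1 : Fin (m₀ + 2) → _) (Fin.succ 0) z) = a * z := by
      rw [← Fin.cons_update, ← prodNE_cons_cons_one (k := m₀) a z]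
      congr 2
      funext i
      cases i using Fin.cases <;> simp
    simpa only [h] using hupdate (Fin.cons a 1) (Fin.succ 0) x y
  have op_mul (x y a : Matrix (Fin n) (Fin n) R) : op x y * a = op (x * a) (y * a) := by
    simpa only [Fin.update_cons_zero, prodNE_cons_cons_one] using
      hupdate (Fin.cons 0 (Fin.cons a 1)) 0 x y
  have map_zero : φ 0 = 0 := by
    obtain ⟨a, ha⟩ := hbij.2 0
    have h := op_mul a a 0
    have h' : φ (op 0 0) = φ 0 + φ 0 := hop 0 0
    simp only [mul_zero] at h
    rw [← h] at h'
    simpa using h'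
  have key := Matrix.op_eq_add op (fun x => hbij.1 (by simp [hop, map_zero]))
    (fun x => hbij.1 (by simp [hop, map_zero])) mul_op op_mul
  intro x y
  rw [← key, hop]
end

section
/- Let R be a unital associative ring, let n ≥ 2 and m ≥ 2, and let d : M_n(R) → M_n(R) be a map such that d(x₁·x₂⋯x_m) = Σ_{i=1}^{m} x₁⋯x_{i-1}·d(x_i)·x_{i+1}⋯x_m for all x₁, …, x_m ∈ M_n(R). Then d is additive, i.e., d(x + y) = d(x) + d(y) for all x, y ∈ M_n(R). -/
theorem prodNE_eq_prod_ofFn {M : Type*} [Monoid M] {m : ℕ} (x : Fin (m + 1) → M) :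
    prodNE x = (List.ofFn x).prod := by
  induction m with
  | zero => simp [prodNE]
  | succ m ih => rw [List.ofFn_succ', List.prod_concat, ← ih, prodNE]

theorem prodNE_cons_cons_s8 {M : Type*} [Monoid M] {m : ℕ} (a b : M) (x : Fin m → M) :
    prodNE (Fin.cons a (Fin.cons b x : Fin (m + 1) → M) : Fin (m + 2) → M) =
      a * b * (List.ofFn x).prod := by
  simp [prodNE_eq_prod_ofFn, List.ofFn_succ, mul_assoc]

/-- Filling all but two slots with `1`, an `m`-multiplicative derivation of a unital ring satisfies
the Leibniz rule up to a right multiple of the product. -/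
theorem exists_leibniz_of_prodNE {A : Type*} [Ring A] {m : ℕ} {d : A → A}
    (hd : ∀ x : Fin (m + 2) → A,
      d (prodNE x) = ∑ i : Fin (m + 2), prodNE (Function.update x i (d (x i)))) :
    ∃ s : A, ∀ a b : A, d (a * b) = d a * b + a * d b + a * b * s := by
  refine ⟨∑ i : Fin m, (List.ofFn (Function.update (fun _ => 1) i (d 1))).prod, fun a b => ?_⟩
  have h := hd (Fin.cons a (Fin.cons b (fun _ => 1) : Fin (m + 1) → A))
  rw [Fin.sum_univ_succ, Fin.sum_univ_succ] at h
  simpa only [Fin.cons_zero, Fin.cons_succ, Fin.update_cons_zero, ← Fin.cons_update,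
    prodNE_cons_cons_s8, List.ofFn_const, List.prod_replicate, one_pow, mul_one, add_assoc,
    Finset.mul_sum] using h

/-- A map on square matrices of size at least two satisfying the Leibniz rule up to a right multiple
of the product is additive. -/
theorem Matrix.map_add_of_leibniz {R ι : Type*} [Ring R] [Fintype ι] [DecidableEq ι] [Nontrivial ι]
    {d : Matrix ι ι R → Matrix ι ι R} {s : Matrix ι ι R}
    (hd : ∀ a b, d (a * b) = d a * b + a * d b + a * b * s) (x y : Matrix ι ι R) :
    d (x + y) = d x + d y := by
  have d_zero : d 0 = 0 := by simpa using hd 0 0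
  have defect_mul (x y z : Matrix ι ι R) :
      (d (x + y) - d x - d y) * z = d (x * z + y * z) - d (x * z) - d (y * z) := by
    rw [← add_mul, hd, hd, hd]
    noncomm_ring
  have eq_zero_of_mul_single {u : Matrix ι ι R} (h : ∀ j, u * single j j 1 = 0) : u = 0 := by
    ext i j
    simpa using congrFun (congrFun (h j) i) j
  rw [← sub_eq_zero, ← sub_sub]
  refine eq_zero_of_mul_single fun j => ?_
  obtain ⟨k, hk⟩ := exists_ne j
  have h : d (x * single j j 1 + y * single j k 1) - d (x * single j j 1)
      - d (y * single j k 1) = 0 := by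
    refine eq_zero_of_mul_single fun l => ?_
    rw [defect_mul, mul_assoc, mul_assoc]
    by_cases hl : j = l
    · subst hl
      simp [single_mul_single_of_ne, hk, d_zero]
    · simp [single_mul_single_of_ne, hl, d_zero]
  have defect_sum := defect_mul (x * single j j 1) (y * single j k 1) (single j j 1 + single k j 1)
  rw [h, zero_mul] at defect_sum
  rw [defect_mul]
  simpa [mul_assoc, mul_add, single_mul_single_of_ne, hk, hk.symm] using defect_sum.symm

/-- For a unital ring `R`, `n ≥ 2` and `m = m₀ + 2 ≥ 2`, every `m`-multiplicative
derivation `d` of `M_n(R)`, i.e. a map satisfying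
`d (x₁ ⋯ x_m) = ∑ i, x₁ ⋯ d (x_i) ⋯ x_m`, is additive (instance of Theorem 3.2 of
Ferreira–Jabeen). -/
theorem m_multiplicative_derivation_additive_of_unital
    {R : Type*} [Ring R]
    (n : ℕ) (hn : 2 ≤ n) (m₀ : ℕ)
    (d : Matrix (Fin n) (Fin n) R → Matrix (Fin n) (Fin n) R)
    (hder : ∀ x : Fin (m₀ + 2) → Matrix (Fin n) (Fin n) R,
      d (prodNE x) = ∑ i : Fin (m₀ + 2), prodNE (Function.update x i (d (x i)))) :
    ∀ x y : Matrix (Fin n) (Fin n) R, d (x + y) = d x + d y := by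
  have : Nontrivial (Fin n) := Fin.nontrivial_iff_two_le.mpr hn
  obtain ⟨s, hs⟩ := exists_leibniz_of_prodNE hder
  exact Matrix.map_add_of_leibniz hs
end

section
/- Let R be a unital associative ring, let n ≥ 2, let S be any associative ring, and let φ : M_n(R) → S be a bijection such that φ(x·y) = φ(x)·φ(y) for all x, y ∈ M_n(R). Then φ is additive, i.e., φ(x + y) = φ(x) + φ(y) for all x, y ∈ M_n(R). -/
namespace Matrix

variable {ι R S : Type*} [Fintype ι] [DecidableEq ι] [Ring R] [NonUnitalRing S]
  {φ : Matrix ι ι R → S}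

theorem single_one_mul_mul_single_one (z : Matrix ι ι R) (i j k l : ι) :
    single i j 1 * z * single k l 1 = single i l (z j k) := by
  rw [single_mul_mul_single, one_mul, mul_one]

theorem map_zero_of_surjective_of_map_mul (hφ : Function.Surjective φ)
    (hmul : ∀ x y, φ (x * y) = φ x * φ y) : φ 0 = 0 := by
  obtain ⟨z, hz⟩ := hφ 0
  rw [← zero_mul z, hmul, hz, mul_zero]

/-- A multiplicative bijection is additive on a pair of matrices as soon as it is additive on
each pair of corresponding entries. -/
theorem map_add_of_map_single_add (hφ : Function.Bijective φ)
    (hmul : ∀ x y, φ (x * y) = φ x * φ y) {x y : Matrix ι ι R}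
    (h : ∀ i j, φ (single i j (x i j + y i j)) = φ (single i j (x i j)) + φ (single i j (y i j))) :
    φ (x + y) = φ x + φ y := by
  obtain ⟨z, hz⟩ := hφ.surjective (φ x + φ y)
  rw [← hz]
  congr 1
  ext i j
  have key : φ (single i j (z i j)) = φ (single i j (x i j + y i j)) := by
    rw [h, ← single_one_mul_mul_single_one z, ← single_one_mul_mul_single_one x,
      ← single_one_mul_mul_single_one y]
    simp only [hmul, hz, mul_add, add_mul]
  simpa using (congrFun₂ (hφ.injective key) i j).symm

theorem map_add_of_disjoint_entries (hφ : Function.Bijective φ)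
    (hmul : ∀ x y, φ (x * y) = φ x * φ y) {x y : Matrix ι ι R}
    (h : ∀ i j, x i j = 0 ∨ y i j = 0) : φ (x + y) = φ x + φ y := by
  have h0 := map_zero_of_surjective_of_map_mul hφ.surjective hmul
  refine map_add_of_map_single_add hφ hmul fun i j => ?_
  rcases h i j with h | h <;> simp [h, h0]

theorem map_single_add_of_ne (hφ : Function.Bijective φ)
    (hmul : ∀ x y, φ (x * y) = φ x * φ y) {i j : ι} (hij : i ≠ j) (a b : R) :
    φ (single i j (a + b)) = φ (single i j a) + φ (single i j b) := by
  have h0 := map_zero_of_surjective_of_map_mul hφ.surjective hmul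
  have hleft : φ (single i i 1 + single i j b) = φ (single i i 1) + φ (single i j b) :=
    map_add_of_disjoint_entries hφ hmul fun k l => by
      simp only [single_apply]; grind
  have hright : φ (single i j a + single j j 1) = φ (single i j a) + φ (single j j 1) :=
    map_add_of_disjoint_entries hφ hmul fun k l => by
      simp only [single_apply]; grind
  have hprod : single i j (a + b) =
      (single i i 1 + single i j b) * (single i j a + single j j 1) := by
    simp [add_mul, mul_add, single_add, hij, hij.symm]
  rw [hprod, hmul, hleft, hright]
  simp only [add_mul, mul_add, ← hmul]
  simp [hij, hij.symm, h0]

theorem map_single_add [Nontrivial ι] (hφ : Function.Bijective φ)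
    (hmul : ∀ x y, φ (x * y) = φ x * φ y) (i j : ι) (a b : R) :
    φ (single i j (a + b)) = φ (single i j a) + φ (single i j b) := by
  obtain ⟨k, hk⟩ := exists_ne i
  have hfactor (c : R) : φ (single i j c) = φ (single i k c) * φ (single k j 1) := by
    rw [← hmul, single_mul_single_same, mul_one]
  rw [hfactor, hfactor a, hfactor b, map_single_add_of_ne hφ hmul hk.symm, add_mul]

end Matrix


/-- For a unital ring `R` and `n ≥ 2`, every multiplicative isomorphism (multiplicative
bijection) `φ` from `M_n(R)` onto a ring `S` is additive (the `m = 2` instance of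
Theorem 3.1 of Ferreira–Jabeen). -/
theorem multiplicative_isomorphism_additive_of_unital
    {R S : Type*} [Ring R] [NonUnitalRing S]
    (n : ℕ) (hn : 2 ≤ n)
    (φ : Matrix (Fin n) (Fin n) R → S)
    (hbij : Function.Bijective φ)
    (hmul : ∀ x y : Matrix (Fin n) (Fin n) R, φ (x * y) = φ x * φ y) :
    ∀ x y : Matrix (Fin n) (Fin n) R, φ (x + y) = φ x + φ y := by
  have : Nontrivial (Fin n) := Fin.nontrivial_iff_two_le.mpr hn
  exact fun x y => Matrix.map_add_of_map_single_add hbij hmul fun i j =>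
    Matrix.map_single_add hbij hmul i j _ _
end

section
/- Let R be a unital associative ring, let n ≥ 2, and let d : M_n(R) → M_n(R) be a map such that d(x·y) = d(x)·y + x·d(y) for all x, y ∈ M_n(R). Then d is additive, i.e., d(x + y) = d(x) + d(y) for all x, y ∈ M_n(R). -/
/-- The failure of a map `d` to be additive at the pair `(x, y)`. -/
def additivityDefect {A : Type*} [AddGroup A] (d : A → A) (x y : A) : A :=
  d (x + y) - d x - d y

section MultiplicativeDerivation

variable {A : Type*} [NonUnitalRing A] {d : A → A}

theorem map_zero_of_multiplicative_derivation
    (hder : ∀ x y, d (x * y) = d x * y + x * d y) : d 0 = 0 := by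
  simpa using hder 0 0

theorem mul_additivityDefect (hder : ∀ x y, d (x * y) = d x * y + x * d y) (z x y : A) :
    z * additivityDefect d x y = additivityDefect d (z * x) (z * y) := by
  simp only [additivityDefect, ← mul_add, hder]
  noncomm_ring

theorem additivityDefect_mul (hder : ∀ x y, d (x * y) = d x * y + x * d y) (x y z : A) :
    additivityDefect d x y * z = additivityDefect d (x * z) (y * z) := by
  simp only [additivityDefect, ← add_mul, hder]
  noncomm_ring

theorem additivityDefect_zero_left (h0 : d 0 = 0) (x : A) : additivityDefect d 0 x = 0 := by
  simp [additivityDefect, h0]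

theorem additivityDefect_zero_right (h0 : d 0 = 0) (x : A) : additivityDefect d x 0 = 0 := by
  simp [additivityDefect, h0]

end MultiplicativeDerivation

namespace Matrix

variable {m R : Type*} [Fintype m] [DecidableEq m] [Ring R]

theorem eq_zero_of_forall_single_mul {M : Matrix m m R}
    (h : ∀ k, single k k (1 : R) * M = 0) : M = 0 := by
  ext i j
  simpa using congrFun (congrFun (h i) i) j

theorem eq_zero_of_forall_mul_single {M : Matrix m m R}
    (h : ∀ k, M * single k k (1 : R) = 0) : M = 0 := by
  ext i j
  simpa using congrFun (congrFun (h j) i) j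

variable {d : Matrix m m R → Matrix m m R}

theorem additivityDefect_single_same_row (hder : ∀ x y, d (x * y) = d x * y + x * d y)
    {i j l : m} (hjl : j ≠ l) (a b : R) :
    additivityDefect d (single i j a) (single i l b) = 0 := by
  have h0 := map_zero_of_multiplicative_derivation hder
  refine eq_zero_of_forall_mul_single fun k => ?_
  rw [additivityDefect_mul hder]
  rcases eq_or_ne j k with rfl | hk
  · rw [single_mul_single_of_ne (h := hjl.symm), additivityDefect_zero_right h0]
  · rw [single_mul_single_of_ne (h := hk), additivityDefect_zero_left h0]

theorem additivityDefect_single_same_col (hder : ∀ x y, d (x * y) = d x * y + x * d y)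
    {i j l : m} (hil : i ≠ l) (a b : R) :
    additivityDefect d (single i j a) (single l j b) = 0 := by
  have h0 := map_zero_of_multiplicative_derivation hder
  refine eq_zero_of_forall_single_mul fun k => ?_
  rw [mul_additivityDefect hder]
  rcases eq_or_ne k i with rfl | hk
  · rw [single_mul_single_of_ne (h := hil), additivityDefect_zero_right h0]
  · rw [single_mul_single_of_ne (h := hk), additivityDefect_zero_left h0]

theorem additivityDefect_single_of_ne (hder : ∀ x y, d (x * y) = d x * y + x * d y)
    {i j : m} (hij : i ≠ j) (a b : R) :
    additivityDefect d (single i j a) (single i j b) = 0 := by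
  have h0 := map_zero_of_multiplicative_derivation hder
  have hu : d (single i i 1 + single i j a) = d (single i i 1) + d (single i j a) := by
    simpa [additivityDefect, sub_sub, sub_eq_zero] using
      additivityDefect_single_same_row hder hij 1 a
  have hv : d (single i j b + single j j 1) = d (single i j b) + d (single j j 1) := by
    simpa [additivityDefect, sub_sub, sub_eq_zero] using
      additivityDefect_single_same_col hder hij b 1
  have hb := hder (single i i 1) (single i j b)
  have hz := hder (single i i 1) (single j j 1)
  have hab := hder (single i j a) (single i j b)
  have ha := hder (single i j a) (single j j 1)
  have huv := hder (single i i 1 + single i j a) (single i j b + single j j 1)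
  have hprod : (single i i 1 + single i j a) * (single i j b + single j j 1) =
      single i j a + single i j b := by
    simp [add_mul, mul_add, hij, hij.symm, add_comm]
  rw [hprod, hu, hv] at huv
  simp only [single_mul_single_same, one_mul, mul_one] at hb ha
  rw [single_mul_single_of_ne (h := hij), h0] at hz
  rw [single_mul_single_of_ne (h := hij.symm), h0] at hab
  have hsum : d (single i j a + single i j b) = d (single i j a) + d (single i j b) := by
    have h := congrArg₂ (· + ·) (congrArg₂ (· + ·) ha hb) (congrArg₂ (· + ·) hz hab)
    simp only [add_zero] at h
    rw [h, huv]
    noncomm_ring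
  simp [additivityDefect, hsum]

theorem additivityDefect_single [Nontrivial m]
    (hder : ∀ x y, d (x * y) = d x * y + x * d y) (i j : m) (a b : R) :
    additivityDefect d (single i j a) (single i j b) = 0 := by
  obtain ⟨k, hk⟩ := exists_ne j
  have h := mul_additivityDefect hder (single i k 1) (single k j a) (single k j b)
  rw [additivityDefect_single_of_ne hder hk] at h
  simpa using h.symm

theorem additivityDefect_eq_zero [Nontrivial m]
    (hder : ∀ x y, d (x * y) = d x * y + x * d y) (x y : Matrix m m R) :
    additivityDefect d x y = 0 := by
  refine eq_zero_of_forall_single_mul fun i => eq_zero_of_forall_mul_single fun j => ?_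
  rw [mul_additivityDefect hder, additivityDefect_mul hder]
  simpa only [single_mul_mul_single, one_mul, mul_one] using
    additivityDefect_single hder i j (x i j) (y i j)

end Matrix

/-- For a unital ring `R` and `n ≥ 2`, every multiplicative derivation `d` of `M_n(R)`,
i.e. a map (no additivity assumed) satisfying `d (x * y) = d x * y + x * d y`, is
additive (the `m = 2` instance of Theorem 3.2 of Ferreira–Jabeen). -/
theorem multiplicative_derivation_additive_of_unital
    {R : Type*} [Ring R]
    (n : ℕ) (hn : 2 ≤ n)
    (d : Matrix (Fin n) (Fin n) R → Matrix (Fin n) (Fin n) R)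
    (hder : ∀ x y : Matrix (Fin n) (Fin n) R, d (x * y) = d x * y + x * d y) :
    ∀ x y : Matrix (Fin n) (Fin n) R, d (x + y) = d x + d y := by
  obtain ⟨m, rfl⟩ := Nat.exists_eq_add_of_le' hn
  intro x y
  simpa [additivityDefect, sub_sub, sub_eq_zero] using Matrix.additivityDefect_eq_zero hder x y
end
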